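/- Let (A,(f)) be of reduced prismatic type. Let M and N be f-adically complete A-modules such that M/f^nM and N/f^nN are flat over A/f^nA for every n ≥ 1. Let T = lim_n (M ⊗_A N)/f^n(M ⊗_A N) be the f-adic completion of M ⊗_A N. Then T is f-adically complete, for every n ≥ 1 the canonical map T/f^nT → (M ⊗_A N)/f^n(M ⊗_A N) is an isomorphism and these quotients are flat over A/f^nA, and Tor_i^A(T, A/fA) = 0 for all i ≥ 1. -/

import Mathlib

set_option synthInstance.maxHeartbeats 400000

open TensorProduct CategoryTheory

universe u

section Defs
variable (A : Type u) [CommRing A]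

/-- `M` is derived `f`-complete: `Hom_A(A_f, M) = 0` and `Ext¹_A(A_f, M) = 0`,
where `A_f = A[1/f]`. -/
noncomputable def DerivedComplete (f : A) (M : Type u) [AddCommGroup M] [Module A M] : Prop :=
  (∀ g : Localization.Away f →ₗ[A] M, g = 0) ∧
  Subsingleton (((Ext A (ModuleCat.{u} A) 1).obj
      (Opposite.op (ModuleCat.of A (Localization.Away f)))).obj (ModuleCat.of A M))

/-- `Tor_i^A(M, N) = 0` for all `i ≥ 1`. -/
noncomputable def TorVanish (M N : Type u) [AddCommGroup M] [Module A M]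
    [AddCommGroup N] [Module A N] : Prop :=
  ∀ i : ℕ, 1 ≤ i →
    Subsingleton (((Tor (ModuleCat.{u} A) i).obj (ModuleCat.of A M)).obj (ModuleCat.of A N))

end Defs

section AdicallyFlat

variable {A : Type u} [CommRing A]

/-- The equational criterion for flatness of `X / f ^ n X` over `A / f ^ n A`, for all `n ≥ 1`:
every finite system of linear relations modulo `f ^ n` is trivial modulo `f ^ n`. -/
def AdicallyFlat (f : A) (X : Type u) [AddCommGroup X] [Module A X] : Prop :=
  ∀ n : ℕ, 1 ≤ n → ∀ (ι κ : Type u) [Finite ι] [Fintype κ] (a : ι → κ → A) (x : κ → X),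
    (∀ i, ∃ w : X, ∑ j, a i j • x j = f ^ n • w) →
    ∃ (τ : Type u) (_ : Fintype τ) (b : κ → τ → A) (y : τ → X) (z : κ → X),
      (∀ j, x j = ∑ l, b j l • y l + f ^ n • z j) ∧ ∀ i l, ∃ e, ∑ j, a i j * b j l = f ^ n * e

/-- The `f ^ m`-torsion of `X` is generated by the `f ^ m`-torsion of `A`. -/
def TorsionGenerated (f : A) (X : Type u) [AddCommGroup X] [Module A X] : Prop :=
  ∀ (m : ℕ) (x : X), f ^ m • x = 0 → x ∈ Submodule.torsionBy A A (f ^ m) • (⊤ : Submodule A X)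

section

variable {X : Type u} [AddCommGroup X] [Module A X]

theorem mem_span_singleton_pow_smul_top (f : A) (n : ℕ) (x : X) :
    x ∈ (Ideal.span {f} ^ n • (⊤ : Submodule A X)) ↔ ∃ w : X, x = f ^ n • w := by
  rw [Ideal.span_singleton_pow, Submodule.ideal_span_singleton_smul,
    Submodule.mem_smul_pointwise_iff_exists]
  simp [eq_comm]

theorem one_tmul_eq_zero_iff (I : Ideal A) (x : X) :
    (1 : A ⧸ I) ⊗ₜ[A] x = 0 ↔ x ∈ I • (⊤ : Submodule A X) := by
  rw [← (quotTensorEquivQuotSMul X I).map_eq_zero_iff, ← map_one (Ideal.Quotient.mk I),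
    quotTensorEquivQuotSMul_mk_tmul, one_smul, Submodule.Quotient.mk_eq_zero]

theorem exists_one_tmul_eq (I : Ideal A) (u : (A ⧸ I) ⊗[A] X) :
    ∃ x : X, u = (1 : A ⧸ I) ⊗ₜ[A] x := by
  induction u with
  | zero => exact ⟨0, by simp⟩
  | tmul r x =>
    obtain ⟨r, rfl⟩ := Ideal.Quotient.mk_surjective r
    refine ⟨r • x, ?_⟩
    rw [TensorProduct.tmul_smul, TensorProduct.smul_tmul', Algebra.smul_def, mul_one]
    rfl
  | add u v hu hv =>
    obtain ⟨x, rfl⟩ := hu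
    obtain ⟨y, rfl⟩ := hv
    exact ⟨x + y, by rw [TensorProduct.tmul_add]⟩

theorem mk_smul_one_tmul (I : Ideal A) (a : A) (x : X) :
    Ideal.Quotient.mk I a • ((1 : A ⧸ I) ⊗ₜ[A] x) = (1 : A ⧸ I) ⊗ₜ[A] (a • x) := by
  rw [TensorProduct.tmul_smul, ← algebraMap_smul (A ⧸ I) a]
  rfl

theorem exists_trivialization_of_flat {S Y : Type*} [CommRing S] [AddCommGroup Y] [Module S Y]
    [Module.Flat S Y] {ι κ : Type*} [Fintype ι] [Fintype κ] (a : ι → κ → S) (x : κ → Y)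
    (h : ∀ i, ∑ j, a i j • x j = 0) :
    ∃ (k : ℕ) (b : κ → Fin k → S) (y : Fin k → Y),
      (∀ j, x j = ∑ l, b j l • y l) ∧ ∀ i l, ∑ j, a i j * b j l = 0 := by
  classical
  let g : (ι →₀ S) →ₗ[S] (κ →₀ S) :=
    Finsupp.linearCombination S (fun i ↦ ∑ j, a i j • Finsupp.single j 1)
  let φ : (κ →₀ S) →ₗ[S] Y := Finsupp.linearCombination S x
  have hg (i : ι) : g (Finsupp.single i 1) = ∑ j, a i j • Finsupp.single j 1 := by
    simp [g]
  have hφ (j : κ) : φ (Finsupp.single j 1) = x j := by simp [φ]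
  have hφg : φ ∘ₗ g = 0 := by
    refine Finsupp.lhom_ext' fun i ↦ LinearMap.ext_ring ?_
    change φ (g (Finsupp.single i 1)) = 0
    simp only [hg, map_sum, map_smul, hφ, h]
  obtain ⟨k, b, y, hb, hbg⟩ := Module.Flat.exists_factorization_of_comp_eq_zero_of_free hφg
  refine ⟨k, fun j l ↦ b (Finsupp.single j 1) l, fun l ↦ y (Finsupp.single l 1), fun j ↦ ?_,
    fun i l ↦ ?_⟩
  · have : b (Finsupp.single j 1) = ∑ l, b (Finsupp.single j 1) l • Finsupp.single l 1 := by
      ext l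
      simp
    rw [← hφ, hb, LinearMap.comp_apply]
    conv_lhs => rw [this]
    simp only [map_sum, map_smul]
  · have := DFunLike.congr_fun (LinearMap.congr_fun hbg (Finsupp.single i 1)) l
    rw [LinearMap.comp_apply, hg] at this
    simpa only [map_sum, map_smul, Finsupp.finsetSum_apply, Finsupp.smul_apply, smul_eq_mul,
      LinearMap.zero_apply, Finsupp.coe_zero, Pi.zero_apply] using this

theorem AdicallyFlat.of_flat (f : A)
    (h : ∀ n : ℕ, 1 ≤ n →
      Module.Flat (A ⧸ (Ideal.span {f} ^ n)) ((A ⧸ (Ideal.span {f} ^ n)) ⊗[A] X)) :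
    AdicallyFlat f X := by
  intro n hn ι κ _ _ a x hax
  have := Fintype.ofFinite ι
  have := h n hn
  set I : Ideal A := Ideal.span {f} ^ n with hI
  obtain ⟨k, b, y, hb, hab⟩ := exists_trivialization_of_flat
    (fun i j ↦ Ideal.Quotient.mk I (a i j)) (fun j ↦ (1 : A ⧸ I) ⊗ₜ[A] x j) fun i ↦ by
      simp only [mk_smul_one_tmul, ← TensorProduct.tmul_sum]
      exact (one_tmul_eq_zero_iff I _).2 ((mem_span_singleton_pow_smul_top f n _).2 (hax i))
  choose b' hb' using fun (j : κ) (l : Fin k) ↦ Ideal.Quotient.mk_surjective (b j l)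
  choose y' hy' using fun l : Fin k ↦ exists_one_tmul_eq I (y l)
  have hxj (j : κ) : ∃ z : X, x j - ∑ l, b' j l • y' l = f ^ n • z := by
    rw [← mem_span_singleton_pow_smul_top, ← one_tmul_eq_zero_iff, TensorProduct.tmul_sub,
      sub_eq_zero, hb]
    simp only [hy', ← hb', mk_smul_one_tmul, TensorProduct.tmul_sum]
  choose z hz using hxj
  refine ⟨ULift (Fin k), inferInstance, fun j l ↦ b' j l.down, fun l ↦ y' l.down, z,
    fun j ↦ ?_, fun i l ↦ ?_⟩
  · rw [← hz j, ← Equiv.sum_comp Equiv.ulift.symm]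
    simp
  · have h3 : Ideal.Quotient.mk I (∑ j, a i j * b' j l.down) = 0 := by
      simpa only [map_sum, map_mul, hb'] using hab i l.down
    rw [Ideal.Quotient.eq_zero_iff_mem, hI, Ideal.span_singleton_pow,
      Ideal.mem_span_singleton] at h3
    exact h3

theorem exists_sum_of_mem_smul_top {J : Ideal A} {x : X} (h : x ∈ J • (⊤ : Submodule A X)) :
    ∃ (τ : Type u) (_ : Fintype τ) (a : τ → A) (y : τ → X),
      (∀ l, a l ∈ J) ∧ x = ∑ l, a l • y l := by
  have htop : (⊤ : Submodule A X) = Submodule.span A (Set.range (id : X → X)) := by simp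
  rw [htop, Submodule.mem_ideal_smul_span_iff_exists_sum] at h
  obtain ⟨a, ha, rfl⟩ := h
  refine ⟨a.support, inferInstance, fun l ↦ a l, fun l ↦ l, fun l ↦ ha l, ?_⟩
  rw [Finsupp.sum, ← Finset.sum_coe_sort]
  rfl

variable {f : A} {c : ℕ}

theorem AdicallyFlat.exists_of_torsion
    (hc : ∀ x : A, (∃ n : ℕ, f ^ n * x = 0) → f ^ c * x = 0)
    (hX : AdicallyFlat f X) {m n : ℕ} (hn : 1 ≤ n)
    (hcn : c ≤ n) {κ : Type u} [Fintype κ] (a : κ → A)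
    (ha : ∀ j, a j ∈ Submodule.torsionBy A A (f ^ m)) (x : κ → X)
    (w : X) (h : ∑ j, a j • x j = f ^ n • w) :
    ∃ (τ : Type u) (_ : Fintype τ) (b : κ → τ → A) (y : τ → X) (z : κ → X),
      (∀ j, x j = ∑ l, b j l • y l + f ^ n • z j) ∧ ∀ l, ∑ j, a j * b j l = 0 := by
  obtain ⟨τ, _, b, y, z, hx, hb⟩ := hX n hn PUnit κ (fun _ ↦ a) x (fun _ ↦ ⟨w, h⟩)
  refine ⟨τ, inferInstance, b, y, z, hx, fun l ↦ ?_⟩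
  obtain ⟨e, he⟩ := hb ⟨⟩ l
  have h0 : f ^ m * (f ^ n * e) = 0 := by
    rw [← he, Finset.mul_sum]
    refine Finset.sum_eq_zero fun j _ ↦ ?_
    rw [← mul_assoc, show f ^ m * a j = 0 from ha j, zero_mul]
  have h1 : f ^ c * e = 0 := hc e ⟨m + n, by rw [pow_add, mul_assoc, h0]⟩
  rw [he, ← Nat.sub_add_cancel hcn, pow_add, mul_assoc, h1, mul_zero]

theorem AdicallyFlat.eq_zero_of_mem_torsionBy_smul_top
    (hc : ∀ x : A, (∃ n : ℕ, f ^ n * x = 0) → f ^ c * x = 0)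
    (hX : AdicallyFlat f X) {m n : ℕ} (hn : 1 ≤ n) (hcn : c ≤ n) {t w : X}
    (ht : t ∈ Submodule.torsionBy A A (f ^ m) • (⊤ : Submodule A X)) (h : t = f ^ n • w) :
    t = 0 := by
  obtain ⟨κ, _, a, x, ha, rfl⟩ := exists_sum_of_mem_smul_top ht
  obtain ⟨τ, _, b, y, z, hx, hb⟩ := hX.exists_of_torsion hc hn hcn a ha x w h
  have hfa (j : κ) : a j * f ^ n = 0 := by
    rw [mul_comm, ← Nat.sub_add_cancel hcn, pow_add, mul_assoc, hc (a j) ⟨m, ha j⟩, mul_zero]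
  simp only [hx, smul_add, smul_smul, hfa, zero_smul, add_zero, Finset.smul_sum]
  rw [Finset.sum_comm]
  simp only [← Finset.sum_smul, hb, zero_smul, Finset.sum_const_zero]

theorem AdicallyFlat.exists_eq_add_of_torsion (hX : AdicallyFlat f X) {m : ℕ} {x : X}
    (hx : f ^ m • x = 0) (n : ℕ) :
    ∃ t ∈ Submodule.torsionBy A A (f ^ m) • (⊤ : Submodule A X), ∃ w, x = t + f ^ n • w := by
  obtain ⟨τ, _, b, y, z, hxz, hb⟩ := hX (m + n + 1) (by lia) PUnit PUnit (fun _ _ ↦ f ^ m)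
    (fun _ ↦ x) (fun _ ↦ ⟨0, by simpa using hx⟩)
  choose e he using hb ⟨⟩
  simp only [Finset.univ_unique, Finset.sum_singleton] at he
  refine ⟨∑ l, (b default l - f ^ (n + 1) * e l) • y l, Submodule.sum_mem _ fun l _ ↦
    Submodule.smul_mem_smul ?_ trivial, f • ∑ l, e l • y l + f ^ (m + 1) • z default, ?_⟩
  · change f ^ m * _ = 0
    rw [mul_sub, he]
    ring
  · conv_lhs => rw [hxz default]
    simp only [sub_smul, Finset.sum_sub_distrib, smul_add, mul_smul, ← Finset.smul_sum]
    simp only [smul_smul, ← pow_succ, ← pow_add, show n + (m + 1) = m + n + 1 by ring]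
    abel

theorem AdicallyFlat.torsionGenerated [IsHausdorff (Ideal.span {f}) X]
    (hc : ∀ x : A, (∃ n : ℕ, f ^ n * x = 0) → f ^ c * x = 0) (hX : AdicallyFlat f X) :
    TorsionGenerated f X := by
  intro m x hx
  choose t ht w hw using fun n ↦ hX.exists_eq_add_of_torsion hx (n + (c + 1))
  have htt (n : ℕ) : t n = t 0 := by
    rw [← sub_eq_zero]
    refine hX.eq_zero_of_mem_torsionBy_smul_top hc (n := c + 1) (by lia) (by lia)
      (Submodule.sub_mem _ (ht n) (ht 0)) (w := w 0 - f ^ n • w n) ?_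
    have h := (hw n).symm.trans (hw 0)
    rw [zero_add, pow_add, mul_comm, mul_smul] at h
    rw [smul_sub, sub_eq_sub_iff_add_eq_add, h, add_comm]
  have : x - t 0 = 0 := by
    refine IsHausdorff.haus ‹IsHausdorff (Ideal.span {f}) X› _ fun n ↦ ?_
    rw [SModEq.zero, mem_span_singleton_pow_smul_top]
    refine ⟨f ^ (c + 1) • w n, ?_⟩
    rw [← htt n, smul_smul, ← pow_add, sub_eq_iff_eq_add']
    exact hw n
  rw [sub_eq_zero.1 this]
  exact ht 0

theorem AdicallyFlat.adicCompletion (hX : AdicallyFlat f X) :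
    AdicallyFlat f (AdicCompletion (Ideal.span {f}) X) := by
  intro n hn ι κ _ _ a x hax
  have hker (u : AdicCompletion (Ideal.span {f}) X) :
      AdicCompletion.eval (Ideal.span {f}) X n u = 0 ↔ ∃ w, u = f ^ n • w := by
    rw [← mem_span_singleton_pow_smul_top,
      AdicCompletion.pow_smul_top_eq_ker_eval (Submodule.fg_span_singleton f), LinearMap.mem_ker]
  have hof (v : X) : AdicCompletion.eval (Ideal.span {f}) X n
      (AdicCompletion.of (Ideal.span {f}) X v) = 0 ↔ ∃ w, v = f ^ n • w := by
    rw [AdicCompletion.eval_of, ← mem_span_singleton_pow_smul_top, Submodule.mkQ_apply,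
      Submodule.Quotient.mk_eq_zero]
  have hlift (j : κ) : ∃ v w, x j = AdicCompletion.of (Ideal.span {f}) X v + f ^ n • w := by
    obtain ⟨v, hv⟩ := Submodule.mkQ_surjective _ (AdicCompletion.eval (Ideal.span {f}) X n (x j))
    obtain ⟨w, hw⟩ := (hker (x j - AdicCompletion.of (Ideal.span {f}) X v)).1 (by
      rw [map_sub, AdicCompletion.eval_of, hv, sub_self])
    exact ⟨v, w, sub_eq_iff_eq_add'.1 hw⟩
  choose v w hvw using hlift
  obtain ⟨τ, _, b, y, z, hv, hb⟩ := hX n hn ι κ a v fun i ↦ by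
    obtain ⟨w', hw'⟩ := hax i
    refine (hof _).1 ((hker _).2 ⟨w' - ∑ j, a i j • w j, ?_⟩)
    simp only [hvw, smul_add, Finset.sum_add_distrib, smul_comm _ (f ^ n),
      ← Finset.smul_sum] at hw'
    rw [smul_sub, map_sum, ← hw', add_sub_cancel_right]
    simp only [map_smul]
  refine ⟨τ, inferInstance, b, fun l ↦ AdicCompletion.of _ _ (y l),
    fun j ↦ AdicCompletion.of _ _ (z j) + w j, fun j ↦ ?_, hb⟩
  rw [hvw, hv]
  simp only [map_add, map_sum, map_smul, smul_add]
  abel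

theorem TorsionGenerated.exists_mem_ker_of_eq_smul {F : Type u} [AddCommGroup F] [Module A F]
    (hX : TorsionGenerated f X) {p : F →ₗ[A] X} (hp : Function.Surjective p) {n : ℕ} {x : F}
    (hx : f ^ n • x ∈ LinearMap.ker p) : ∃ k ∈ LinearMap.ker p, f ^ n • x = f ^ n • k := by
  obtain ⟨τ, _, a, y, ha, h⟩ := exists_sum_of_mem_smul_top
    (hX n (p x) (by rw [← map_smul]; exact hx))
  choose y' hy' using fun l ↦ hp (y l)
  refine ⟨x - ∑ l, a l • y' l, ?_, ?_⟩
  · rw [LinearMap.mem_ker, map_sub, h, map_sum]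
    simp only [map_smul, hy', sub_self]
  · have : ∑ l, f ^ n • a l • y' l = 0 := Finset.sum_eq_zero fun l _ ↦ by
      rw [smul_smul, show f ^ n * a l = 0 from ha l, zero_smul]
    rw [smul_sub, Finset.smul_sum, this, sub_zero]

theorem AdicallyFlat.torsionGenerated_ker
    (hc : ∀ x : A, (∃ n : ℕ, f ^ n * x = 0) → f ^ c * x = 0) (hX : AdicallyFlat f X)
    {σ : Type u} {p : (σ →₀ A) →ₗ[A] X} (hp : Function.Surjective p) :
    TorsionGenerated f (LinearMap.ker p) := by
  rintro m ⟨k, hk⟩ hfk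
  have hfk : f ^ m • k = 0 := congr_arg Subtype.val hfk
  have hsum : k = ∑ j : k.support, k j • Finsupp.single (j : σ) (1 : A) := by
    conv_lhs => rw [← Finsupp.sum_single k, Finsupp.sum, ← Finset.sum_coe_sort]
    simp
  have ha (j : k.support) : k j ∈ Submodule.torsionBy A A (f ^ m) :=
    DFunLike.congr_fun hfk (j : σ)
  obtain ⟨τ, _, b, y, z, hx, hb⟩ := hX.exists_of_torsion hc (n := c + 1) (by lia) (by lia)
    (fun j : k.support ↦ k j) ha (fun j ↦ p (Finsupp.single (j : σ) 1)) 0 (by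
      rw [smul_zero, ← LinearMap.mem_ker.1 hk]
      conv_rhs => rw [hsum]
      simp only [map_sum, map_smul])
  choose y' hy' using fun l ↦ hp (y l)
  choose z' hz' using fun j ↦ hp (z j)
  have hmem (j : k.support) : Finsupp.single (j : σ) 1 - ∑ l, b j l • y' l - f ^ (c + 1) • z' j ∈
      LinearMap.ker p := by
    rw [LinearMap.mem_ker]
    simp only [map_sub, map_sum, map_smul, hx, hy', hz']
    abel
  have hka (j : k.support) : k j * f ^ (c + 1) = 0 := by
    rw [mul_comm, pow_succ', mul_assoc, hc (k j) ⟨m, ha j⟩, mul_zero]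
  have : (⟨k, hk⟩ : LinearMap.ker p) = ∑ j : k.support, k j • ⟨_, hmem j⟩ := by
    ext1
    rw [AddSubmonoidClass.coe_finsetSum]
    simp only [SetLike.mk_smul_mk, smul_sub, Finset.sum_sub_distrib, ← hsum, smul_smul, hka,
      zero_smul, sub_zero, Finset.smul_sum]
    rw [Finset.sum_comm]
    simp only [← Finset.sum_smul, hb, zero_smul, Finset.sum_const_zero, sub_zero]
  rw [this]
  exact Submodule.sum_mem _ fun j _ ↦ Submodule.smul_mem_smul (ha j) trivial

theorem AdicallyFlat.ker (hX : AdicallyFlat f X) (hX' : TorsionGenerated f X)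
    {σ : Type u} {p : (σ →₀ A) →ₗ[A] X} (hp : Function.Surjective p) :
    AdicallyFlat f (LinearMap.ker p) := by
  classical
  intro n hn ι κ _ _ a k hak
  let s : Finset σ := Finset.univ.biUnion fun j ↦ (k j : σ →₀ A).support
  have hsum (j : κ) : (k j : σ →₀ A) = ∑ i : s, (k j : σ →₀ A) i • Finsupp.single (i : σ) 1 := by
    conv_lhs => rw [← Finsupp.sum_single (k j : σ →₀ A)]
    rw [Finsupp.sum_of_support_subset (s := s) _ (Finset.subset_biUnion_of_mem
      (fun j ↦ (k j : σ →₀ A).support) (Finset.mem_univ j)) _ (by simp), ← Finset.sum_coe_sort]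
    simp
  obtain ⟨τ, _, b, y, z, hx, hb⟩ := hX n hn κ s (fun j i ↦ (k j : σ →₀ A) i)
    (fun i ↦ p (Finsupp.single (i : σ) 1)) (fun j ↦ ⟨0, by
      rw [smul_zero, ← LinearMap.mem_ker.1 (k j).2]
      conv_rhs => rw [hsum]
      simp only [map_sum, map_smul]⟩)
  choose e he using hb
  choose y' hy' using fun l ↦ hp (y l)
  choose z' hz' using fun j ↦ hp (z j)
  have hmem (i : s) : Finsupp.single (i : σ) 1 - ∑ l, b i l • y' l - f ^ n • z' i ∈
      LinearMap.ker p := by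
    rw [LinearMap.mem_ker]
    simp only [map_sub, map_sum, map_smul, hx, hy', hz']
    abel
  have hk (j : κ) : (k j : σ →₀ A) =
      ∑ i : s, (k j : σ →₀ A) i • (Finsupp.single (i : σ) 1 - ∑ l, b i l • y' l - f ^ n • z' i) +
        f ^ n • (∑ l, e j l • y' l + ∑ i : s, (k j : σ →₀ A) i • z' i) := by
    have h1 : ∑ i : s, (k j : σ →₀ A) i • ∑ l, b i l • y' l = f ^ n • ∑ l, e j l • y' l := by
      simp only [Finset.smul_sum, smul_smul]
      rw [Finset.sum_comm]
      simp only [← Finset.sum_smul, he]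
    have h2 : ∑ i : s, (k j : σ →₀ A) i • f ^ n • z' i =
        f ^ n • ∑ i : s, (k j : σ →₀ A) i • z' i := by
      simp only [Finset.smul_sum, smul_comm (f ^ n)]
    simp only [smul_sub, Finset.sum_sub_distrib, ← hsum, h1, h2, smul_add]
    abel
  have hz (j : κ) : ∃ w : LinearMap.ker p,
      f ^ n • (∑ l, e j l • y' l + ∑ i : s, (k j : σ →₀ A) i • z' i) = f ^ n • (w : σ →₀ A) := by
    obtain ⟨w, hw, h⟩ := hX'.exists_mem_ker_of_eq_smul hp (n := n)
      (x := ∑ l, e j l • y' l + ∑ i : s, (k j : σ →₀ A) i • z' i) (by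
        rw [← sub_eq_iff_eq_add'.2 (hk j)]
        exact Submodule.sub_mem _ (k j).2
          (Submodule.sum_mem _ fun i _ ↦ Submodule.smul_mem _ _ (hmem i)))
    exact ⟨⟨w, hw⟩, h⟩
  choose w hw using hz
  refine ⟨s, inferInstance, fun j i ↦ (k j : σ →₀ A) i, fun i ↦ ⟨_, hmem i⟩, w, fun j ↦ ?_,
    fun i i' ↦ ?_⟩
  · ext1
    rw [Submodule.coe_add, AddSubmonoidClass.coe_finsetSum, Submodule.coe_smul, ← hw]
    exact hk j
  · obtain ⟨w', hw'⟩ := hak i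
    refine ⟨(w' : σ →₀ A) i', ?_⟩
    have := DFunLike.congr_fun (congr_arg Subtype.val hw') (i' : σ)
    rw [AddSubmonoidClass.coe_finsetSum] at this
    simpa [Finsupp.finsetSum_apply] using this

end

end AdicallyFlat

section Tor

variable {A : Type u} [CommRing A]

theorem TorsionGenerated.rTensor_subtype_ker_injective {f : A} {X F : Type u} [AddCommGroup X]
    [Module A X] [AddCommGroup F] [Module A F] (hX : TorsionGenerated f X) {p : F →ₗ[A] X}
    (hp : Function.Surjective p) :
    Function.Injective ((LinearMap.ker p).subtype.rTensor (A ⧸ Ideal.span {f})) := by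
  rw [← LinearMap.lTensor_inj_iff_rTensor_inj, injective_iff_map_eq_zero]
  intro u hu
  obtain ⟨k, rfl⟩ := exists_one_tmul_eq _ u
  rw [LinearMap.lTensor_tmul, one_tmul_eq_zero_iff, ← pow_one (Ideal.span {f}),
    mem_span_singleton_pow_smul_top] at hu
  obtain ⟨x, hx⟩ := hu
  obtain ⟨k', hk', h⟩ := hX.exists_mem_ker_of_eq_smul hp (n := 1) (x := x) (by
    rw [← hx]
    exact k.2)
  rw [one_tmul_eq_zero_iff, ← pow_one (Ideal.span {f}), mem_span_singleton_pow_smul_top]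
  exact ⟨⟨k', hk'⟩, Subtype.ext (hx.trans h)⟩

theorem rTensor_lTensor_comm {P Q C D : Type*} [AddCommGroup P] [Module A P] [AddCommGroup Q]
    [Module A Q] [AddCommGroup C] [Module A C] [AddCommGroup D] [Module A D] (g : P →ₗ[A] Q)
    (d : C →ₗ[A] D) (u : P ⊗[A] C) :
    g.rTensor D (d.lTensor P u) = d.lTensor Q (g.rTensor C u) := by
  rw [← LinearMap.comp_apply, ← LinearMap.comp_apply, LinearMap.rTensor_comp_lTensor,
    LinearMap.lTensor_comp_rTensor]

theorem lTensor_exact_of_shortExact {K F X C₃ C₂ C₁ C₀ : Type*} [AddCommGroup K] [Module A K]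
    [AddCommGroup F] [Module A F] [AddCommGroup X] [Module A X] [AddCommGroup C₃] [Module A C₃]
    [AddCommGroup C₂] [Module A C₂] [AddCommGroup C₁] [Module A C₁] [AddCommGroup C₀] [Module A C₀]
    {i : K →ₗ[A] F} {p : F →ₗ[A] X} (hip : Function.Exact i p) (hp : Function.Surjective p)
    {d₃ : C₃ →ₗ[A] C₂} {d₂ : C₂ →ₗ[A] C₁} {d₁ : C₁ →ₗ[A] C₀}
    (h₃₂ : d₂ ∘ₗ d₃ = 0) (h₂₁ : d₁ ∘ₗ d₂ = 0)
    (hK : Function.Exact (d₂.lTensor K) (d₁.lTensor K))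
    (hF : Function.Exact (d₃.lTensor F) (d₂.lTensor F))
    (hi : Function.Injective (i.rTensor C₀)) :
    Function.Exact (d₃.lTensor X) (d₂.lTensor X) := by
  intro t
  constructor
  · intro ht
    obtain ⟨x, rfl⟩ := LinearMap.rTensor_surjective C₂ hp t
    rw [← rTensor_lTensor_comm] at ht
    obtain ⟨k, hk⟩ := (rTensor_exact C₁ hip hp _).1 ht
    have hk0 : d₁.lTensor K k = 0 := by
      apply hi
      rw [rTensor_lTensor_comm, hk, ← LinearMap.lTensor_comp_apply, h₂₁, LinearMap.lTensor_zero,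
        LinearMap.zero_apply, map_zero]
    obtain ⟨k₂, rfl⟩ := (hK k).1 hk0
    obtain ⟨y, hy⟩ := (hF (x - i.rTensor C₂ k₂)).1 (by rw [map_sub, ← hk, rTensor_lTensor_comm, sub_self])
    refine ⟨p.rTensor C₃ y, ?_⟩
    rw [← rTensor_lTensor_comm, hy, map_sub, sub_eq_self]
    exact (rTensor_exact C₂ hip hp).apply_apply_eq_zero k₂
  · rintro ⟨y, rfl⟩
    rw [← LinearMap.lTensor_comp_apply, h₃₂, LinearMap.lTensor_zero, LinearMap.zero_apply]

theorem torVanish_of_exact {X B : Type u} [AddCommGroup X] [Module A X] [AddCommGroup B]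
    [Module A B] (P : ProjectiveResolution (ModuleCat.of A B))
    (h : ∀ n : ℕ, Function.Exact ((P.complex.d (n + 2) (n + 1)).hom.lTensor X)
      ((P.complex.d (n + 1) n).hom.lTensor X)) :
    TorVanish A X B := by
  rintro (_ | i) hi
  · lia
  have hex : (((((MonoidalCategory.tensoringLeft (ModuleCat.{u} A)).obj
      (ModuleCat.of A X)).mapHomologicalComplex _).obj P.complex).ExactAt (i + 1)) := by
    rw [HomologicalComplex.exactAt_iff' _ (i + 2) (i + 1) i (by simp only [ChainComplex.prev]; rfl)
      (by simp), ShortComplex.ShortExact.moduleCat_exact_iff_function_exact]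
    exact h i
  exact ModuleCat.subsingleton_of_isZero
    (((HomologicalComplex.exactAt_iff_isZero_homology _ _).1 hex).of_iso
      (P.isoLeftDerivedObj ((MonoidalCategory.tensoringLeft (ModuleCat.{u} A)).obj (ModuleCat.of A X)) (i + 1)))

theorem AdicallyFlat.lTensor_exact {f : A} {c : ℕ}
    (hc : ∀ x : A, (∃ n : ℕ, f ^ n * x = 0) → f ^ c * x = 0)
    (P : ProjectiveResolution (ModuleCat.of A (A ⧸ Ideal.span {f}))) (n : ℕ)
    {X : Type u} [AddCommGroup X] [Module A X] (hX : AdicallyFlat f X)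
    (hX' : TorsionGenerated f X) :
    Function.Exact ((P.complex.d (n + 2) (n + 1)).hom.lTensor X)
      ((P.complex.d (n + 1) n).hom.lTensor X) := by
  have hP (n : ℕ) : Function.Exact (P.complex.d (n + 2) (n + 1)).hom
      (P.complex.d (n + 1) n).hom :=
    (ShortComplex.ShortExact.moduleCat_exact_iff_function_exact _).1 (P.exact_succ n)
  have hflat (n : ℕ) : Module.Flat A (P.complex.X n) := by
    have := P.projective n
    infer_instance
  have hp : Function.Surjective (Finsupp.linearCombination A (id : X → X)) :=
    fun x ↦ ⟨Finsupp.single x 1, by simp⟩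
  induction n generalizing X with
  | zero =>
    let e : ModuleCat.of A (A ⧸ Ideal.span {f}) ≅
        ((ChainComplex.single₀ (ModuleCat.{u} A)).obj
          (ModuleCat.of A (A ⧸ Ideal.span {f}))).X 0 := Iso.refl _
    let ε : P.complex.X 0 ⟶ ModuleCat.of A (A ⧸ Ideal.span {f}) := P.π.f 0 ≫ e.inv
    have hε : Function.Surjective ε.hom := (ModuleCat.epi_iff_surjective ε).1 inferInstance
    have hdε : Function.Exact (P.complex.d (0 + 1) 0).hom ε.hom :=
      (ShortComplex.ShortExact.moduleCat_exact_iff_function_exact _).1 P.exact₀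
    exact lTensor_exact_of_shortExact (LinearMap.exact_subtype_ker_map _) hp
      (hP 0).linearMap_comp_eq_zero hdε.linearMap_comp_eq_zero
      (_root_.lTensor_exact (LinearMap.ker (Finsupp.linearCombination A (id : X → X))) hdε hε) (Module.Flat.lTensor_exact _ (hP 0))
      (hX'.rTensor_subtype_ker_injective hp)
  | succ n ih =>
    exact lTensor_exact_of_shortExact (LinearMap.exact_subtype_ker_map _) hp
      (hP (n + 1)).linearMap_comp_eq_zero (hP n).linearMap_comp_eq_zero
      (ih (hX.ker hX' hp) (hX.torsionGenerated_ker hc hp) fun x ↦ ⟨Finsupp.single x 1, by simp⟩)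
      (Module.Flat.lTensor_exact _ (hP (n + 1)))
      (Module.Flat.rTensor_preserves_injective_linearMap _ (Submodule.subtype_injective _))

end Tor

/-- Let `(A,(f))` be of reduced prismatic type and `M`, `N` `f`-adically
complete `A`-modules with flat quotients mod `f^n`. Let `T` be the `f`-adic completion of
`M ⊗_A N`. Then `T` is `f`-adically complete; for every `n ≥ 1` the canonical map
`T/f^nT → (M ⊗_A N)/f^n(M ⊗_A N)` is an isomorphism (evaluation is surjective with kernel
`f^nT`) and these quotients are flat over `A/f^nA`; and `Tor_i^A(T, A/fA) = 0` for `i ≥ 1`. -/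
theorem completed_tensor_of_flat (A : Type u) [CommRing A] (f : A)
    (hder : DerivedComplete A f A)
    (hbdd : ∃ c : ℕ, ∀ x : A, (∃ n : ℕ, f ^ n * x = 0) → f ^ c * x = 0)
    (M N : Type u) [AddCommGroup M] [Module A M] [AddCommGroup N] [Module A N]
    (hMc : IsAdicComplete (Ideal.span {f}) M)
    (hNc : IsAdicComplete (Ideal.span {f}) N)
    (hMflat : ∀ n : ℕ, 1 ≤ n →
      Module.Flat (A ⧸ (Ideal.span {f} ^ n)) ((A ⧸ (Ideal.span {f} ^ n)) ⊗[A] M))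
    (hNflat : ∀ n : ℕ, 1 ≤ n →
      Module.Flat (A ⧸ (Ideal.span {f} ^ n)) ((A ⧸ (Ideal.span {f} ^ n)) ⊗[A] N)) :
    IsAdicComplete (Ideal.span {f}) (AdicCompletion (Ideal.span {f}) (M ⊗[A] N)) ∧
    (∀ n : ℕ, 1 ≤ n →
      (Function.Surjective (AdicCompletion.eval (Ideal.span {f}) (M ⊗[A] N) n) ∧
        LinearMap.ker (AdicCompletion.eval (Ideal.span {f}) (M ⊗[A] N) n) =
          (Ideal.span {f} ^ n •
            (⊤ : Submodule A (AdicCompletion (Ideal.span {f}) (M ⊗[A] N))))) ∧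
      Module.Flat (A ⧸ (Ideal.span {f} ^ n)) ((A ⧸ (Ideal.span {f} ^ n)) ⊗[A] (M ⊗[A] N))) ∧
    TorVanish A (AdicCompletion (Ideal.span {f}) (M ⊗[A] N)) (A ⧸ Ideal.span {f}) := by
  obtain ⟨c, hc⟩ := hbdd
  have hfg : (Ideal.span {f}).FG := Submodule.fg_span_singleton f
  have hcomp : IsAdicComplete (Ideal.span {f}) (AdicCompletion (Ideal.span {f}) (M ⊗[A] N)) :=
    AdicCompletion.isAdicComplete hfg
  have hflat (n : ℕ) (hn : 1 ≤ n) :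
      Module.Flat (A ⧸ (Ideal.span {f} ^ n)) ((A ⧸ (Ideal.span {f} ^ n)) ⊗[A] (M ⊗[A] N)) := by
    have := hMflat n hn
    have := hNflat n hn
    exact Module.Flat.of_linearEquiv
      (TensorProduct.AlgebraTensorModule.distribBaseChange A (A ⧸ (Ideal.span {f} ^ n)) M N)
  refine ⟨hcomp, fun n hn ↦ ⟨⟨AdicCompletion.eval_surjective _ _ n,
    (AdicCompletion.pow_smul_top_eq_ker_eval hfg).symm⟩, hflat n hn⟩, ?_⟩
  have hT := (AdicallyFlat.of_flat f hflat).adicCompletion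
  have P := projectiveResolution (ModuleCat.of A (A ⧸ Ideal.span {f}))
  exact torVanish_of_exact P fun n ↦ hT.lTensor_exact hc P n (hT.torsionGenerated hc)
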